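/- Let e≥2, s∈𝒜^l_e and let 𝛌 be an l-partition. Every maximal sequence of elementary operations starting from (𝛌,s) (i.e. applied until the resulting l-abacus is (e,v)-complete for the current multicharge v) has length exactly p_{(e,s)}(𝛌) and terminates at the same pair (𝛍,v), which satisfies: v_1+…+v_l = s_1+…+s_l, 𝛍 is a reduced (e,v)-core, and τ_{e,v}(𝛍) = Core_e(τ_{e,s}(𝛌)). In particular the core of (𝛌,s) is well defined, independent of the order in which elementary operations are performed. -/

import Mathlib

noncomputable section

/-- A partition: a nonincreasing sequence of nonnegative integers with finitely many
nonzero terms. `parts j` is the `(j+1)`-st part `λ_{j+1}` (0-indexed). -/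
structure Ptn where
  parts : ℕ → ℕ
  antitone' : ∀ ⦃i j : ℕ⦄, i ≤ j → parts j ≤ parts i
  eventually_zero : ∃ N, ∀ n, N ≤ n → parts n = 0

/-- The empty partition. -/
def Ptn.empty : Ptn := ⟨fun _ => 0, fun _ _ _ => le_rfl, ⟨0, fun _ _ => rfl⟩⟩

/-- The abacus `L_s(λ) = {λ_j − j + s : j ∈ ℤ_{>0}}` of a partition with charge `s`. -/
def abacus (s : ℤ) (lam : Ptn) : Set ℤ :=
  {x | ∃ j : ℕ, x = (lam.parts j : ℤ) - ((j : ℤ) + 1) + s}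

/-- The Young diagram of an `l`-partition, with 0-indexed rows and columns:
`(a, b, c) ∈ diag 𝛌` represents the node in row `a+1`, column `b+1` of component `c`. -/
def diag {l : ℕ} (lam : Fin l → Ptn) : Set (ℕ × ℕ × Fin l) :=
  {x | x.2.1 < (lam x.2.2).parts x.1}

/-- The rank of an `l`-partition: the number of nodes of its Young diagram. -/
def rank {l : ℕ} (lam : Fin l → Ptn) : ℕ := (diag lam).ncard

/-- The rank of a partition. -/
def rank₁ (lam : Ptn) : ℕ := rank (fun _ : Fin 1 => lam)

/-- The residue of the node `(a,b,c)` (0-indexed), i.e. `(b+1) − (a+1) + s_c mod e`. -/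
def res (e : ℕ) {l : ℕ} (s : Fin l → ℤ) (x : ℕ × ℕ × Fin l) : ZMod e :=
  (((x.2.1 : ℤ) - (x.1 : ℤ) + s x.2.2 : ℤ) : ZMod e)

/-- `c^{e,s}_i(𝛌)`: the number of nodes of `𝛌` of residue `i`. -/
def resCount (e : ℕ) {l : ℕ} (s : Fin l → ℤ) (lam : Fin l → Ptn) (i : ZMod e) : ℕ :=
  {x ∈ diag lam | res e s x = i}.ncard

/-- `c^{e,(t)}_i(λ)` for a single partition with charge `t`. -/
def resCount₁ (e : ℕ) (t : ℤ) (lam : Ptn) (i : ZMod e) : ℕ :=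
  resCount e (fun _ : Fin 1 => t) (fun _ => lam) i

/-- A node `γ` of `𝛌` is removable if deleting it yields the Young diagram
of an `l`-partition. -/
def Removable {l : ℕ} (lam : Fin l → Ptn) (γ : ℕ × ℕ × Fin l) : Prop :=
  γ ∈ diag lam ∧ ∃ mu : Fin l → Ptn, diag mu = diag lam \ {γ}

/-- A node `γ ∉ [𝛌]` is addable for `𝛌` if adding it yields the Young diagram
of an `l`-partition. -/
def Addable {l : ℕ} (lam : Fin l → Ptn) (γ : ℕ × ℕ × Fin l) : Prop :=
  γ ∉ diag lam ∧ ∃ mu : Fin l → Ptn, diag mu = diag lam ∪ {γ}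

/-- `M^s_i(𝛌)`: the number of addable nodes of residue `i` minus the number of
removable nodes of residue `i`. -/
def Mnum (e : ℕ) {l : ℕ} (s : Fin l → ℤ) (lam : Fin l → Ptn) (i : ZMod e) : ℤ :=
  ({γ | Addable lam γ ∧ res e s γ = i}.ncard : ℤ) -
    ({γ | Removable lam γ ∧ res e s γ = i}.ncard : ℤ)

/-- `M^{(t)}_i(λ)` for a single partition with charge `t`. -/
def Mnum₁ (e : ℕ) (t : ℤ) (lam : Ptn) (i : ZMod e) : ℤ :=
  Mnum e (fun _ : Fin 1 => t) (fun _ => lam) i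

/-- The block `(e,s)`-weight of Fayers:
`p_{(e,s)}(𝛌) = Σ_{i=1}^{l} c_{s_i}(𝛌) − (1/2) Σ_{i ∈ ℤ/eℤ} (c_i(𝛌) − c_{i−1}(𝛌))²`. -/
def blockWeight (e : ℕ) {l : ℕ} (s : Fin l → ℤ) (lam : Fin l → Ptn) : ℚ :=
  (∑ i : Fin l, (resCount e s lam ((s i : ZMod e)) : ℚ)) -
    (1 / 2) * ∑ i ∈ Finset.range e,
      ((resCount e s lam ((i : ZMod e)) : ℚ) - (resCount e s lam ((i : ZMod e) - 1) : ℚ)) ^ 2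

/-- Block weight of a single partition with charge `t`. -/
def blockWeight₁ (e : ℕ) (t : ℤ) (lam : Ptn) : ℚ :=
  blockWeight e (fun _ : Fin 1 => t) (fun _ => lam)

/-- The `l`-abacus `(L_{s_1}(λ^1),…,L_{s_l}(λ^l))` is `(e,s)`-complete:
`L_{s_1}(λ^1) ⊆ … ⊆ L_{s_l}(λ^l) ⊆ {x+e : x ∈ L_{s_1}(λ^1)}`. -/
def Complete (e : ℕ) {l : ℕ} (s : Fin l → ℤ) (lam : Fin l → Ptn) : Prop :=
  (∀ i j : Fin l, (j : ℕ) = (i : ℕ) + 1 →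
      abacus (s i) (lam i) ⊆ abacus (s j) (lam j)) ∧
  (∀ i j : Fin l, (i : ℕ) = l - 1 → (j : ℕ) = 0 →
      abacus (s i) (lam i) ⊆ {x | x - (e : ℤ) ∈ abacus (s j) (lam j)})

/-- `𝒜̄^l_e = {s ∈ ℤ^l : 0 ≤ s_j − s_i ≤ e for all i < j}`. -/
def Abar (e : ℕ) {l : ℕ} (s : Fin l → ℤ) : Prop :=
  ∀ i j : Fin l, i < j → 0 ≤ s j - s i ∧ s j - s i ≤ (e : ℤ)

/-- `𝒜^l_e = {s ∈ ℤ^l : 0 ≤ s_j − s_i < e for all i < j}`. -/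
def Aset (e : ℕ) {l : ℕ} (s : Fin l → ℤ) : Prop :=
  ∀ i j : Fin l, i < j → 0 ≤ s j - s i ∧ s j - s i < (e : ℤ)

/-- A partition is an `e`-core if its abacus is stable under subtracting `e`
(a condition independent of the charge). -/
def IsECore (e : ℕ) (lam : Ptn) : Prop :=
  ∀ x ∈ abacus 0 lam, x - (e : ℤ) ∈ abacus 0 lam

/-- The permutation `σ_s`: the unique permutation sorting the residues
`s'_i = s_i mod e ∈ {0,…,e−1}` increasingly and stably. -/
def sigmaPerm (e : ℕ) {l : ℕ} (s : Fin l → ℤ) : Equiv.Perm (Fin l) :=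
  Tuple.sort (fun i => s i % (e : ℤ))

/-- `𝛌` is an `(e,s)`-core if `𝛌^{σ_s}` is a reduced `(e, s̃^{σ_s})`-core. -/
def IsCore (e : ℕ) {l : ℕ} (s : Fin l → ℤ) (lam : Fin l → Ptn) : Prop :=
  Complete e (fun i => s (sigmaPerm e s i) % (e : ℤ)) (fun i => lam (sigmaPerm e s i))

/-- The set `{(l−c)e + q·e·l + r : 1 ≤ c ≤ l, q ∈ ℤ, 0 ≤ r ≤ e−1, qe+r ∈ L_{s_c}(λ^c)}`
(with `c = (c' : Fin l) + 1`). -/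
def uglovSet (e : ℕ) {l : ℕ} (s : Fin l → ℤ) (lam : Fin l → Ptn) : Set ℤ :=
  {y | ∃ (c : Fin l) (q : ℤ) (r : ℕ), r < e ∧
      (q * (e : ℤ) + (r : ℤ)) ∈ abacus (s c) (lam c) ∧
      y = ((l : ℤ) - 1 - ((c : ℕ) : ℤ)) * (e : ℤ) + q * (e : ℤ) * (l : ℤ) + (r : ℤ)}

/-- `μ = τ_{e,s}(𝛌)`: the Uglov map sends `𝛌` to the unique partition `μ` whose abacus
with charge `t = s_1 + … + s_l` is the Uglov set of `(𝛌,s)`. -/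
def IsUglov (e : ℕ) {l : ℕ} (s : Fin l → ℤ) (lam : Fin l → Ptn) (mu : Ptn) : Prop :=
  abacus (∑ i, s i) mu = uglovSet e s lam

/-- An elementary operation on a pair (`l`-partition, multicharge), performed on the
associated `l`-abacus. -/
def ElemOp (e : ℕ) {l : ℕ} (p q : (Fin l → Ptn) × (Fin l → ℤ)) : Prop :=
  (∃ (i j : Fin l) (x : ℤ), (j : ℕ) = (i : ℕ) + 1 ∧
      x ∈ abacus (p.2 i) (p.1 i) ∧ x ∉ abacus (p.2 j) (p.1 j) ∧
      abacus (q.2 i) (q.1 i) = abacus (p.2 i) (p.1 i) \ {x} ∧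
      abacus (q.2 j) (q.1 j) = abacus (p.2 j) (p.1 j) ∪ {x} ∧
      q.2 i = p.2 i - 1 ∧ q.2 j = p.2 j + 1 ∧
      (∀ k, k ≠ i → k ≠ j → q.1 k = p.1 k ∧ q.2 k = p.2 k)) ∨
  (∃ (i j : Fin l) (x : ℤ), (i : ℕ) = l - 1 ∧ (j : ℕ) = 0 ∧
      x ∈ abacus (p.2 i) (p.1 i) ∧ x - (e : ℤ) ∉ abacus (p.2 j) (p.1 j) ∧
      (i = j → abacus (q.2 i) (q.1 i) = (abacus (p.2 i) (p.1 i) \ {x}) ∪ {x - (e : ℤ)} ∧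
        q.2 i = p.2 i) ∧
      (i ≠ j → abacus (q.2 i) (q.1 i) = abacus (p.2 i) (p.1 i) \ {x} ∧
        abacus (q.2 j) (q.1 j) = abacus (p.2 j) (p.1 j) ∪ {x - (e : ℤ)} ∧
        q.2 i = p.2 i - 1 ∧ q.2 j = p.2 j + 1) ∧
      (∀ k, k ≠ i → k ≠ j → q.1 k = p.1 k ∧ q.2 k = p.2 k))

/-- A sequence of `n` elementary operations starting from `p`. -/
def OpSeq (e : ℕ) {l : ℕ} (p : (Fin l → Ptn) × (Fin l → ℤ))
    (f : ℕ → (Fin l → Ptn) × (Fin l → ℤ)) (n : ℕ) : Prop :=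
  f 0 = p ∧ ∀ k < n, ElemOp e (f k) (f (k + 1))

/-- A maximal sequence of elementary operations: performed until the resulting
`l`-abacus is complete for the current multicharge. -/
def MaxOpSeq (e : ℕ) {l : ℕ} (p : (Fin l → Ptn) × (Fin l → ℤ))
    (f : ℕ → (Fin l → Ptn) × (Fin l → ℤ)) (n : ℕ) : Prop :=
  OpSeq e p f n ∧ Complete e (f n).2 (f n).1

/-- `q` is the core of the pair `p`: it is reached from `p` by a maximal sequence
of elementary operations. -/
def IsCorePairOf (e : ℕ) {l : ℕ} (p q : (Fin l → Ptn) × (Fin l → ℤ)) : Prop :=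
  ∃ f n, MaxOpSeq e p f n ∧ f n = q

/-- `κ = Core_e(λ)`: on abaci, the abacus of `κ` is obtained from that of `λ` by
repeatedly replacing an element `y` with `y − e ∉ L` by `y − e`, until no such
replacement is possible. -/
def IsECoreOf (e : ℕ) (kappa lam : Ptn) : Prop :=
  IsECore e kappa ∧ ∃ (f : ℕ → Ptn) (m : ℕ), f 0 = lam ∧ f m = kappa ∧
    ∀ k < m, ∃ y ∈ abacus 0 (f k), y - (e : ℤ) ∉ abacus 0 (f k) ∧
      abacus 0 (f (k + 1)) = (abacus 0 (f k) \ {y}) ∪ {y - (e : ℤ)}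

end


noncomputable section Aux

open Classical in
/-- weight of a position relative to the vacuum -/
def relInd (L : Set ℤ) (x : ℤ) : ℚ := (if x ∈ L then 1 else 0) - (if x < 0 then 1 else 0)

/-- bead sets comparable with the vacuum `x < 0` -/
def Good (L : Set ℤ) : Prop := {x : ℤ | ¬ (x ∈ L ↔ x < 0)}.Finite

/-- relative sum of `G` over the beads in `L` -/
def RS (G : ℤ → ℚ) (L : Set ℤ) : ℚ := ∑ᶠ x, relInd L x * G x

lemma relInd_congr {L L' : Set ℤ} {x x' : ℤ} (h : x ∈ L ↔ x' ∈ L') (h' : x < 0 ↔ x' < 0) :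
    relInd L x = relInd L' x' := by
  unfold relInd
  by_cases h1 : x ∈ L <;> by_cases h2 : x < 0
  all_goals
    have h3 := h1
    have h4 := h2
    rw [h] at h3
    rw [h'] at h4
    simp only [h1, h2, h3, h4, if_true, if_false]

lemma relInd_ne {L : Set ℤ} {x : ℤ} (h : relInd L x ≠ 0) : ¬ (x ∈ L ↔ x < 0) := by
  intro h2
  apply h
  unfold relInd
  by_cases hx : x < 0
  · simp [hx, h2.2 hx]
  · have : x ∉ L := fun h => hx (h2.1 h)
    simp [hx, this]

lemma Good.supp {L : Set ℤ} (h : Good L) (G : ℤ → ℚ) :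
    (Function.support fun x => relInd L x * G x).Finite := by
  refine Set.Finite.subset h ?_
  intro x hx
  exact relInd_ne (left_ne_zero_of_mul hx)

lemma Good.insert {L : Set ℤ} (h : Good L) (a : ℤ) : Good (L ∪ {a}) := by
  refine Set.Finite.subset (Set.Finite.union h (Set.finite_singleton a)) ?_
  intro x hx
  by_cases hxa : x = a
  · right; exact hxa
  · left
    simpa [hxa] using hx

lemma Good.erase {L : Set ℤ} (h : Good L) (a : ℤ) : Good (L \ {a}) := by
  refine Set.Finite.subset (Set.Finite.union h (Set.finite_singleton a)) ?_
  intro x hx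
  by_cases hxa : x = a
  · right; exact hxa
  · left
    simpa [hxa] using hx

lemma RS_insert {L : Set ℤ} (h : Good L) (G : ℤ → ℚ) {a : ℤ} (ha : a ∉ L) :
    RS G (L ∪ {a}) = RS G L + G a := by
  unfold RS
  have h1 : (fun x => relInd (L ∪ {a}) x * G x)
      = fun x => relInd L x * G x + (if x = a then G a else 0) := by
    funext x
    by_cases hxa : x = a
    · subst hxa
      have : x ∈ L ∪ {x} := by simp
      simp only [relInd, ha, this, if_true, if_false]; ring
    · rw [relInd_congr (L' := L) (x' := x) (by simp [hxa]) Iff.rfl]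
      simp [hxa]
  rw [h1, finsum_add_distrib (h.supp G)]
  · congr 1
    rw [finsum_eq_single _ a]
    · simp
    · intro x hx; simp [hx]
  · refine Set.Finite.subset (Set.finite_singleton a) ?_
    intro x hx
    by_contra hxa
    simp at hxa
    simp [hxa] at hx

lemma RS_erase {L : Set ℤ} (h : Good L) (G : ℤ → ℚ) {a : ℤ} (ha : a ∈ L) :
    RS G (L \ {a}) = RS G L - G a := by
  have := RS_insert (h.erase a) G (a := a) (by simp)
  have h2 : L \ {a} ∪ {a} = L := by
    ext x; by_cases hx : x = a <;> simp [hx, ha]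
  rw [h2] at this
  linarith

lemma Good.move {L : Set ℤ} (h : Good L) (a b : ℤ) : Good ((L \ {a}) ∪ {b}) :=
  (h.erase a).insert b

lemma RS_move {L : Set ℤ} (h : Good L) (G : ℤ → ℚ) {a b : ℤ} (ha : a ∈ L) (hb : b ∉ L) :
    RS G ((L \ {a}) ∪ {b}) = RS G L - G a + G b := by
  rw [RS_insert (h.erase a) G (fun h => hb h.1), RS_erase h G ha]

lemma good_Iio (s : ℤ) : Good (Set.Iio s) := by
  refine Set.Finite.subset (Set.finite_Icc (-|s|) (|s|)) ?_
  intro x hx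
  change ¬ (x < s ↔ x < 0) at hx
  have := le_abs_self s
  have := neg_abs_le s
  simp only [Set.mem_Icc]
  by_contra hc
  apply hx
  constructor <;> intro <;> by_contra <;> apply hc <;> constructor <;> omega

lemma Iio_succ_eq (s : ℤ) : Set.Iio (s + 1) = Set.Iio s ∪ {s} := by
  ext x
  simp only [Set.mem_Iio, Set.mem_union, Set.mem_singleton_iff]
  omega

lemma RS_Iio_succ (G : ℤ → ℚ) (s : ℤ) : RS G (Set.Iio (s + 1)) = RS G (Set.Iio s) + G s := by
  rw [Iio_succ_eq, RS_insert (good_Iio s) G (by simp)]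

lemma RS_Iio_zero (G : ℤ → ℚ) : RS G (Set.Iio 0) = 0 := by
  unfold RS
  have : (fun x => relInd (Set.Iio 0) x * G x) = fun _ => 0 := by
    funext x; simp [relInd]
  rw [this, finsum_zero]

/-- evaluate via a discrete antiderivative -/
lemma RS_Iio_eq (G H : ℤ → ℚ) (h : ∀ s, H (s + 1) = H s + G s) (s : ℤ) :
    RS G (Set.Iio s) = H s - H 0 := by
  induction s using Int.induction_on with
  | zero => rw [RS_Iio_zero]; ring
  | succ k ih => rw [RS_Iio_succ, ih, h]; ring
  | pred k ih =>
    have h1 := RS_Iio_succ G (-(k:ℤ) - 1)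
    have h2 := h (-(k:ℤ) - 1)
    rw [sub_add_cancel] at h1 h2
    rw [ih] at h1
    linarith

lemma RS_sum {ι : Type*} (S : Finset ι) (a : ι → ℚ) (G : ι → ℤ → ℚ) {L : Set ℤ} (h : Good L) :
    ∑ i ∈ S, a i * RS (G i) L = RS (fun x => ∑ i ∈ S, a i * G i x) L := by
  unfold RS
  have h1 : ∀ i, a i * ∑ᶠ x, relInd L x * G i x = ∑ᶠ x, a i * (relInd L x * G i x) :=
    fun i => mul_finsum (fun x => relInd L x * G i x) (a i)
  simp only [h1]
  rw [← finsum_sum_comm]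
  · apply finsum_congr; intro x; rw [Finset.mul_sum]; apply Finset.sum_congr rfl; intros; ring
  · intro i _
    refine Set.Finite.subset (h.supp (G i)) ?_
    intro x hx
    simp only [Function.mem_support] at hx ⊢
    exact right_ne_zero_of_mul hx

/-- decomposition along a bijection `ι × ℤ → ℤ` -/
lemma RS_decomp {ι : Type*} [Fintype ι] (φ : ι × ℤ → ℤ) (hφ : Function.Bijective φ)
    (hneg : ∀ p, φ p < 0 ↔ p.2 < 0) (U : Set ℤ) (hU : Good U) (G : ℤ → ℚ) :
    RS G U = ∑ i, RS (fun x => G (φ (i, x))) {x | φ (i, x) ∈ U} := by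
  unfold RS
  rw [← finsum_comp_equiv (Equiv.ofBijective φ hφ), finsum_curry, finsum_eq_sum_of_fintype]
  · apply Finset.sum_congr rfl
    intro i _
    apply finsum_congr
    intro x
    simp only [Equiv.ofBijective_apply]
    rw [relInd_congr (L := U) (x := φ (i, x)) (L' := {x | φ (i, x) ∈ U}) (x' := x) Iff.rfl (hneg (i, x))]
  · refine Set.Finite.subset ((hU.supp G).preimage (f := φ) hφ.1.injOn) ?_
    intro p hp
    simpa using hp

lemma good_decomp {ι : Type*} (φ : ι × ℤ → ℤ) (hφ : Function.Bijective φ)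
    (hneg : ∀ p, φ p < 0 ↔ p.2 < 0) (U : Set ℤ) (hU : Good U) (i : ι) :
    Good {x | φ (i, x) ∈ U} := by
  refine Set.Finite.subset (Set.Finite.preimage (f := fun x : ℤ => φ (i, x)) ?_ hU) ?_
  · intro x _ y _ h
    have := hφ.1 h
    simpa using this
  · intro x hx
    simpa [hneg] using hx

lemma good_comp {ι : Type*} [Fintype ι] (φ : ι × ℤ → ℤ) (hφ : Function.Bijective φ)
    (hneg : ∀ p, φ p < 0 ↔ p.2 < 0) (U : Set ℤ) (hU : ∀ i, Good {x | φ (i, x) ∈ U}) :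
    Good U := by
  refine Set.Finite.subset (Set.finite_iUnion (fun i : ι =>
    Set.Finite.image (fun x => φ (i, x)) (hU i))) ?_
  intro y hy
  obtain ⟨⟨i, x⟩, rfl⟩ := hφ.2 y
  simp only [Set.mem_iUnion]
  refine ⟨i, x, ?_, rfl⟩
  simpa [hneg] using hy

/-! ### e-runners -/

lemma runner_bij (e : ℕ) (he : 0 < e) :
    Function.Bijective (fun p : Fin e × ℤ => (e : ℤ) * p.2 + (p.1 : ℕ)) := by
  have he' : (0 : ℤ) < e := by exact_mod_cast he
  constructor
  · rintro ⟨r, k⟩ ⟨r', k'⟩ h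
    simp only at h
    have h1 : ((r : ℕ) : ℤ) < e := by exact_mod_cast r.2
    have h2 : ((r' : ℕ) : ℤ) < e := by exact_mod_cast r'.2
    have hk : k = k' := by
      have a1 : ((e : ℤ) * k + (r : ℕ)) / e = k := by
        rw [Int.mul_add_ediv_left _ _ he'.ne', Int.ediv_eq_zero_of_lt (by omega) h1, add_zero]
      have a2 : ((e : ℤ) * k' + (r' : ℕ)) / e = k' := by
        rw [Int.mul_add_ediv_left _ _ he'.ne', Int.ediv_eq_zero_of_lt (by omega) h2, add_zero]
      rw [← a1, h, a2]
    subst hk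
    have : (r : ℕ) = r' := by omega
    simp [Fin.ext_iff, this]
  · intro y
    have h0 := Int.emod_nonneg y he'.ne'
    have h1 := Int.emod_lt_of_pos y he'
    refine ⟨(⟨(y % e).toNat, by omega⟩, y / e), ?_⟩
    simp only
    rw [Int.toNat_of_nonneg h0]
    exact Int.mul_ediv_add_emod y e

lemma runner_neg (e : ℕ) (he : 0 < e) (p : Fin e × ℤ) :
    (e : ℤ) * p.2 + (p.1 : ℕ) < 0 ↔ p.2 < 0 := by
  have he' : (0 : ℤ) < e := by exact_mod_cast he
  have h1 : ((p.1 : ℕ) : ℤ) < e := by exact_mod_cast p.1.2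
  constructor
  · intro h; by_contra hc; push Not at hc
    have := mul_nonneg he'.le hc
    omega
  · intro h
    have : (e : ℤ) * p.2 ≤ e * (-1) := mul_le_mul_of_nonneg_left (by omega) he'.le
    omega

lemma down_closed_eq (K : Set ℤ) (hK : Good K) (hd : ∀ x ∈ K, x - 1 ∈ K) :
    ∃ m, K = Set.Iio m := by
  obtain ⟨B, hB⟩ := hK.bddAbove
  obtain ⟨A, hA⟩ := hK.bddBelow
  have hd' : ∀ n : ℕ, ∀ x ∈ K, x - n ∈ K := by
    intro n
    induction n with
    | zero => simp
    | succ n ih =>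
      intro x hx
      have := hd _ (ih x hx)
      push_cast
      rwa [← sub_sub]
  have hd2 : ∀ x ∈ K, ∀ y ≤ x, y ∈ K := by
    intro x hx y hy
    have := hd' (x - y).toNat x hx
    rw [Int.toNat_of_nonneg (by omega)] at this
    simpa using this
  have hbound : ∀ x ∈ K, x ≤ max B 0 := by
    intro x hx
    by_cases h0 : x < 0
    · exact le_trans h0.le (le_max_right _ _)
    · exact le_trans (hB (show ¬ (x ∈ K ↔ x < 0) from fun h => h0 (h.1 hx))) (le_max_left _ _)
  have hne : ∃ x, x ∈ K := by
    refine ⟨min (A - 1) (-1), ?_⟩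
    by_contra hc
    have : min (A - 1) (-1) ∈ {x : ℤ | ¬ (x ∈ K ↔ x < 0)} := by
      intro h
      exact hc (h.2 (by have := min_le_right (A - 1) (-1 : ℤ); omega))
    have h1 := hA this
    have := min_le_left (A - 1) (-1 : ℤ)
    omega
  obtain ⟨M, hM, hmax⟩ := Int.exists_greatest_of_bdd ⟨_, hbound⟩ hne
  refine ⟨M + 1, ?_⟩
  ext x
  simp only [Set.mem_Iio]
  constructor
  · intro hx; have := hmax x hx; omega
  · intro hx; exact hd2 M hM x (by omega)

/-- indicator of a residue class -/
def rInd (e : ℕ) (z : ZMod e) (y : ℤ) : ℚ := if (y : ZMod e) = z then 1 else 0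

/-- energy -/
def EN (e : ℕ) (U : Set ℤ) : ℚ := RS (fun y => ((y / (e : ℤ) : ℤ) : ℚ)) U

def nch (e : ℕ) (U : Set ℤ) (z : ZMod e) : ℚ := RS (rInd e z) U

lemma runner_div (e : ℕ) (he : 0 < e) (r : Fin e) (k : ℤ) :
    ((e : ℤ) * k + (r : ℕ)) / e = k := by
  have he' : (0 : ℤ) < e := by exact_mod_cast he
  have h1 : ((r : ℕ) : ℤ) < e := by exact_mod_cast r.2
  rw [Int.mul_add_ediv_left _ _ he'.ne', Int.ediv_eq_zero_of_lt (by omega) h1, add_zero]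

lemma cast_fin_inj (e : ℕ) (r r' : Fin e) : (((r : ℕ) : ZMod e) = ((r' : ℕ) : ZMod e)) ↔ r = r' := by
  rw [ZMod.natCast_eq_natCast_iff, Nat.ModEq, Nat.mod_eq_of_lt r.2, Nat.mod_eq_of_lt r'.2, Fin.ext_iff]

lemma RS_zero (L : Set ℤ) : RS (fun _ => 0) L = 0 := by
  unfold RS; simp

lemma sum_fin_zmod (e : ℕ) [NeZero e] (F : ZMod e → ℚ) :
    ∑ r : Fin e, F ((r : ℕ) : ZMod e) = ∑ z, F z := by
  apply Fintype.sum_bijective (fun r : Fin e => ((r : ℕ) : ZMod e))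
  · rw [Fintype.bijective_iff_injective_and_card]
    refine ⟨fun r r' h => (cast_fin_inj e r r').1 h, by simp [ZMod.card]⟩
  · intro x; rfl

lemma stable_runners (e : ℕ) (he : 0 < e) (U : Set ℤ) (hU : Good U)
    (hs : ∀ y ∈ U, y - e ∈ U) :
    ∃ m : Fin e → ℤ, (∀ r : Fin e, {k : ℤ | (e : ℤ) * k + (r : ℕ) ∈ U} = Set.Iio (m r)) ∧
      (∀ r : Fin e, nch e U ((r : ℕ) : ZMod e) = m r) ∧
      EN e U = ∑ r, (m r : ℚ) * (m r - 1) / 2 := by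
  have hb := runner_bij e he
  have hn := runner_neg e he
  have key : ∀ r : Fin e, ∃ m, {k : ℤ | (e : ℤ) * k + (r : ℕ) ∈ U} = Set.Iio m := by
    intro r
    apply down_closed_eq
    · exact good_decomp _ hb hn U hU r
    · intro x hx
      have := hs _ hx
      have h2 : (e : ℤ) * (x - 1) + (r : ℕ) = (e : ℤ) * x + (r : ℕ) - e := by ring
      simpa [h2] using this
  choose m hm using key
  refine ⟨m, hm, ?_, ?_⟩
  · intro r
    unfold nch
    rw [RS_decomp _ hb hn U hU, Finset.sum_eq_single r]
    · simp only [hm]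
      rw [RS_Iio_eq _ (fun s => (s : ℚ))]
      · simp
      · intro s; simp [rInd]
    · intro r' _ hr'
      have : (fun x : ℤ => rInd e ((r : ℕ) : ZMod e) ((e : ℤ) * x + (r' : ℕ))) = fun _ => 0 := by
        funext x
        simp [rInd, cast_fin_inj, hr']
      simp only [this, RS_zero]
    · simp
  · unfold EN
    rw [RS_decomp _ hb hn U hU]
    apply Finset.sum_congr rfl
    intro r _
    simp only [hm, runner_div e he]
    rw [RS_Iio_eq _ (fun s => (s : ℚ) * (s - 1) / 2)]
    · simp
    · intro s; push_cast; ring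

lemma stable_energy (e : ℕ) [NeZero e] (U : Set ℤ) (hU : Good U)
    (hs : ∀ y ∈ U, y - e ∈ U) :
    EN e U = ∑ z : ZMod e, nch e U z * (nch e U z - 1) / 2 := by
  obtain ⟨m, _, h2, h3⟩ := stable_runners e (Nat.pos_of_neZero e) U hU hs
  rw [h3, ← sum_fin_zmod e (fun z => nch e U z * (nch e U z - 1) / 2)]
  simp only [h2]

lemma stable_unique (e : ℕ) (he : 0 < e) (U V : Set ℤ) (hU : Good U) (hV : Good V)
    (hs : ∀ y ∈ U, y - e ∈ U) (hs' : ∀ y ∈ V, y - e ∈ V) (h : ∀ z, nch e U z = nch e V z) :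
    U = V := by
  obtain ⟨m, h1, h2, _⟩ := stable_runners e he U hU hs
  obtain ⟨m', h1', h2', _⟩ := stable_runners e he V hV hs'
  have hm : ∀ r, m r = m' r := by
    intro r
    have := h2 r
    rw [h, h2' r] at this
    exact_mod_cast this.symm
  ext y
  obtain ⟨⟨r, k⟩, rfl⟩ := (runner_bij e he).2 y
  have a1 : k ∈ {k : ℤ | (e : ℤ) * k + (r : ℕ) ∈ U} ↔ k ∈ {k : ℤ | (e : ℤ) * k + (r : ℕ) ∈ V} := by
    rw [h1, h1', hm]
  simpa using a1

/-! ### removing rim hooks -/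

/-- one bead move -/
def Mv (e : ℕ) (U V : Set ℤ) : Prop := ∃ y ∈ U, y - (e : ℤ) ∉ U ∧ V = (U \ {y}) ∪ {y - (e : ℤ)}

lemma Mv.good {e : ℕ} {U V : Set ℤ} (h : Mv e U V) (hU : Good U) : Good V := by
  obtain ⟨y, _, _, rfl⟩ := h
  exact hU.move _ _

lemma Mv.en {e : ℕ} (he : 0 < e) {U V : Set ℤ} (h : Mv e U V) (hU : Good U) :
    EN e V = EN e U - 1 := by
  obtain ⟨y, h1, h2, rfl⟩ := h
  unfold EN
  rw [RS_move hU _ h1 h2]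
  have he' : (e : ℤ) ≠ 0 := by exact_mod_cast he.ne'
  have : (y - e) / (e : ℤ) = y / e - 1 := by
    rw [Int.sub_ediv_of_dvd _ (dvd_refl _), Int.ediv_self he']
  rw [this]; push_cast; ring

lemma Mv.nch {e : ℕ} {U V : Set ℤ} (h : Mv e U V) (hU : Good U) (z : ZMod e) :
    nch e V z = nch e U z := by
  obtain ⟨y, h1, h2, rfl⟩ := h
  unfold _root_.nch
  rw [RS_move hU _ h1 h2]
  have : rInd e z (y - e) = rInd e z y := by simp [rInd]
  rw [this]; ring

lemma Mv.charge {e : ℕ} {U V : Set ℤ} (h : Mv e U V) (hU : Good U) :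
    RS (fun _ => 1) V = RS (fun _ => 1) U := by
  obtain ⟨y, h1, h2, rfl⟩ := h
  rw [RS_move hU _ h1 h2]; ring

end Aux

noncomputable section Aux2

/-! ### abaci of partitions -/

/-- position of the `j`-th bead -/
def bead (s : ℤ) (lam : Ptn) (j : ℕ) : ℤ := (lam.parts j : ℤ) - ((j : ℤ) + 1) + s

lemma bead_strictAnti (s : ℤ) (lam : Ptn) : StrictAnti (bead s lam) := by
  intro i j hij
  have := lam.antitone' hij.le
  unfold bead
  omega

lemma abacus_eq_range (s : ℤ) (lam : Ptn) : abacus s lam = Set.range (bead s lam) := by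
  ext x
  constructor
  · rintro ⟨j, hj⟩; exact ⟨j, hj.symm⟩
  · rintro ⟨j, hj⟩; exact ⟨j, hj.symm⟩

/-- the set of the `N` first beads together with the vacuum below -/
lemma RS_beads (b : ℕ → ℤ) (hb : StrictAnti b) (t : ℤ) (N : ℕ) (G : ℤ → ℚ)
    (ht : ∀ j < N, t ≤ b j) :
    Good (Set.Iio t ∪ b '' Set.Iio N) ∧
    RS G (Set.Iio t ∪ b '' Set.Iio N) = RS G (Set.Iio t) + ∑ j ∈ Finset.range N, G (b j) := by
  induction N with
  | zero => simp [good_Iio]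
  | succ N ih =>
    obtain ⟨h1, h2⟩ := ih (fun j hj => ht j (by omega))
    have h3 : Set.Iio t ∪ b '' Set.Iio (N + 1) = (Set.Iio t ∪ b '' Set.Iio N) ∪ {b N} := by
      ext x
      simp only [Set.mem_union, Set.mem_Iio, Set.mem_image, Set.mem_singleton_iff]
      constructor
      · rintro (h | ⟨j, hj, rfl⟩)
        · exact Or.inl (Or.inl h)
        · rcases Nat.lt_succ_iff_lt_or_eq.1 hj with h | rfl
          · exact Or.inl (Or.inr ⟨j, h, rfl⟩)
          · exact Or.inr rfl
      · rintro ((h | ⟨j, hj, rfl⟩) | rfl)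
        · exact Or.inl h
        · exact Or.inr ⟨j, by omega, rfl⟩
        · exact Or.inr ⟨N, by omega, rfl⟩
    have h4 : b N ∉ Set.Iio t ∪ b '' Set.Iio N := by
      rintro (h | ⟨j, hj, h⟩)
      · have := ht N (by omega); simp only [Set.mem_Iio] at h; omega
      · have := hb.injective h
        simp only [Set.mem_Iio] at hj; omega
    rw [h3]
    refine ⟨h1.insert _, ?_⟩
    rw [RS_insert h1 G h4, h2, Finset.sum_range_succ]; ring

lemma abacus_split (s : ℤ) (lam : Ptn) (N : ℕ) (hN : ∀ n, N ≤ n → lam.parts n = 0) :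
    abacus s lam = Set.Iio (s - N) ∪ bead s lam '' Set.Iio N := by
  rw [abacus_eq_range]
  ext x
  simp only [Set.mem_union, Set.mem_Iio, Set.mem_image, Set.mem_range]
  constructor
  · rintro ⟨j, rfl⟩
    by_cases h : j < N
    · exact Or.inr ⟨j, h, rfl⟩
    · left
      unfold bead
      rw [hN j (by omega)]
      push_cast
      omega
  · rintro (h | ⟨j, _, rfl⟩)
    · refine ⟨(s - 1 - x).toNat, ?_⟩
      unfold bead
      rw [hN _ (by omega)]
      push_cast
      omega
    · exact ⟨j, rfl⟩

lemma RS_abacus (s : ℤ) (lam : Ptn) (N : ℕ) (hN : ∀ n, N ≤ n → lam.parts n = 0) (G : ℤ → ℚ) :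
    RS G (abacus s lam) = RS G (Set.Iio (s - N)) + ∑ j ∈ Finset.range N, G (bead s lam j) := by
  rw [abacus_split s lam N hN]
  refine (RS_beads _ (bead_strictAnti s lam) _ N G ?_).2
  intro j hj
  unfold bead
  omega

lemma good_abacus (s : ℤ) (lam : Ptn) : Good (abacus s lam) := by
  obtain ⟨N, hN⟩ := lam.eventually_zero
  rw [abacus_split s lam N hN]
  refine (RS_beads _ (bead_strictAnti s lam) _ N (fun _ => 0) ?_).1
  intro j hj
  unfold bead
  omega

lemma abacus_empty (s : ℤ) : abacus s Ptn.empty = Set.Iio s := by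
  rw [abacus_split s Ptn.empty 0 (fun _ _ => rfl)]
  simp

lemma RS_abacus_sub (s : ℤ) (lam : Ptn) (N : ℕ) (hN : ∀ n, N ≤ n → lam.parts n = 0) (G : ℤ → ℚ) :
    RS G (abacus s lam) = RS G (Set.Iio s) + ∑ j ∈ Finset.range N,
      ∑ b ∈ Finset.range (lam.parts j), (G ((b : ℤ) - j + s) - G ((b : ℤ) - j + s - 1)) := by
  have h1 := RS_abacus s lam N hN G
  have h2 := RS_abacus s Ptn.empty N (fun _ _ => rfl) G
  rw [abacus_empty] at h2
  rw [h1, h2, add_assoc, ← Finset.sum_add_distrib]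
  congr 1
  apply Finset.sum_congr rfl
  intro j _
  have h3 := Finset.sum_range_sub (fun b : ℕ => G ((b : ℤ) - j + s - 1)) (lam.parts j)
  have h4 : ∀ b : ℕ, G (((b + 1 : ℕ) : ℤ) - j + s - 1) = G ((b : ℤ) - j + s) := by
    intro b; congr 1; push_cast; ring
  simp only [h4] at h3
  rw [h3]
  have e1 : bead s lam j = (lam.parts j : ℤ) - j + s - 1 := by unfold bead; ring
  have e2 : bead s Ptn.empty j = ((0 : ℕ) : ℤ) - j + s - 1 := by
    unfold bead Ptn.empty; push_cast; ring
  rw [e1, e2]; ring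

lemma charge_abacus (s : ℤ) (lam : Ptn) : RS (fun _ => 1) (abacus s lam) = s := by
  obtain ⟨N, hN⟩ := lam.eventually_zero
  rw [RS_abacus_sub s lam N hN, RS_Iio_eq _ (fun s => (s : ℚ))]
  · simp
  · intro s; push_cast; ring

lemma abacus_inj {s s' : ℤ} {lam lam' : Ptn} (h : abacus s lam = abacus s' lam') :
    lam = lam' ∧ s = s' := by
  have hs : s = s' := by
    have h1 := charge_abacus s lam
    rw [h, charge_abacus] at h1
    exact_mod_cast h1.symm
  subst hs
  refine ⟨?_, rfl⟩
  rw [abacus_eq_range, abacus_eq_range] at h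
  have h2 : (fun j => OrderDual.toDual (bead s lam j)) = fun j => OrderDual.toDual (bead s lam' j) := by
    apply Set.range_injOn_strictMono
    · exact fun i j hij => bead_strictAnti s lam hij
    · exact fun i j hij => bead_strictAnti s lam' hij
    · exact h
  have h3 : lam.parts = lam'.parts := by
    funext j
    have := congrFun h2 j
    have h4 : bead s lam j = bead s lam' j := this
    unfold bead at h4
    omega
  cases lam; cases lam'; simp only at h3; subst h3; rfl

lemma exists_abacus (L : Set ℤ) (hL : Good L) : ∃ t lam, abacus t lam = L := by
  obtain ⟨B', hB'⟩ := hL.bddAbove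
  obtain ⟨A', hA'⟩ := hL.bddBelow
  obtain ⟨B, hB⟩ : ∃ B, ∀ x ∈ L, x ≤ B := by
    refine ⟨max B' 0, fun x hx => ?_⟩
    by_cases h0 : x < 0
    · exact le_trans h0.le (le_max_right _ _)
    · exact le_trans (hB' (show ¬ (x ∈ L ↔ x < 0) from fun h => h0 (h.1 hx))) (le_max_left _ _)
  obtain ⟨A, hA⟩ : ∃ A, ∀ x < A, x ∈ L := by
    refine ⟨min A' 0, fun x hx => ?_⟩
    have h0 : x < 0 := lt_of_lt_of_le hx (min_le_right _ _)
    have h1 : x < A' := lt_of_lt_of_le hx (min_le_left _ _)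
    by_contra hc
    have := hA' (show ¬ (x ∈ L ↔ x < 0) from fun h => hc (h.2 h0))
    omega
  let P : ℕ → Prop := fun n => B - n ∈ L
  have hbig : ∀ n : ℕ, (B - A + 1).toNat ≤ n → P n := fun n hn => hA _ (by omega)
  have hinf : (setOf P).Infinite := by
    refine Set.Infinite.mono ?_ (Set.Ici_infinite (B - A + 1).toNat)
    exact fun n hn => hbig n hn
  have hmono : StrictMono (Nat.nth P) := Nat.nth_strictMono hinf
  have hrange : Set.range (Nat.nth P) = setOf P := Nat.range_nth_of_infinite hinf
  set M := (B - A + 1).toNat with hM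
  -- `nth j - j` is monotone and eventually constant
  have hle : ∀ j, j ≤ Nat.nth P j := fun j => hmono.le_apply
  have hstep : ∀ j, M ≤ j → Nat.nth P (j + 1) = Nat.nth P j + 1 := by
    intro j hj
    have h1 : P (Nat.nth P j + 1) := hbig _ (by have := hle j; omega)
    have h2 : Nat.nth P j + 1 ∈ Set.range (Nat.nth P) := by rw [hrange]; exact h1
    obtain ⟨k, hk⟩ := h2
    have h3 : j < k := hmono.lt_iff_lt.1 (by omega)
    have h4 : Nat.nth P (j + 1) ≤ Nat.nth P k := hmono.monotone h3
    have h5 : Nat.nth P j < Nat.nth P (j + 1) := hmono (by omega)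
    omega
  set D : ℤ := (Nat.nth P M : ℤ) - M with hD
  have hconst : ∀ j, M ≤ j → (Nat.nth P j : ℤ) - j = D := by
    intro j hj
    induction j, hj using Nat.le_induction with
    | base => rfl
    | succ j hj ih => rw [hstep j hj]; push_cast; omega
  have hmon : Monotone (fun j => (Nat.nth P j : ℤ) - j) := by
    apply monotone_nat_of_le_succ
    intro j
    have : Nat.nth P j < Nat.nth P (j + 1) := hmono (by omega)
    push_cast; omega
  have hleD : ∀ j, (Nat.nth P j : ℤ) - j ≤ D := by
    intro j
    have h1 : (Nat.nth P j : ℤ) - j ≤ (Nat.nth P (max j M) : ℤ) - (max j M : ℕ) := hmon (le_max_left j M)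
    rw [hconst _ (le_max_right _ _)] at h1
    exact h1
  refine ⟨B - D + 1, ⟨fun j => (D - ((Nat.nth P j : ℤ) - j)).toNat, ?_, ?_⟩, ?_⟩
  · intro i j hij
    have h1 : (Nat.nth P i : ℤ) - i ≤ (Nat.nth P j : ℤ) - j := hmon hij
    omega
  · refine ⟨M, fun n hn => ?_⟩
    rw [hconst n hn]; simp
  · rw [abacus_eq_range]
    have hbe : ∀ j, (((D - ((Nat.nth P j : ℤ) - j)).toNat : ℕ) : ℤ) - ((j : ℤ) + 1) + (B - D + 1)
        = B - Nat.nth P j := by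
      intro j; have := hleD j; omega
    ext x
    simp only [Set.mem_range, bead, hbe]
    constructor
    · rintro ⟨j, rfl⟩
      have : Nat.nth P j ∈ setOf P := by rw [← hrange]; exact ⟨j, rfl⟩
      exact this
    · intro hx
      have h1 := hB x hx
      have h2 : (B - x).toNat ∈ Set.range (Nat.nth P) := by
        rw [hrange]
        change B - ((B - x).toNat : ℤ) ∈ L
        rw [Int.toNat_of_nonneg (by omega)]; simpa using hx
      obtain ⟨j, hj⟩ := h2
      exact ⟨j, by rw [hj]; omega⟩

lemma exists_abacus_charge (L : Set ℤ) (hL : Good L) (t : ℤ) (ht : RS (fun _ => 1) L = t) :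
    ∃ lam, abacus t lam = L := by
  obtain ⟨t', lam, h⟩ := exists_abacus L hL
  have h1 := charge_abacus t' lam
  rw [h, ht] at h1
  have : t = t' := by exact_mod_cast h1
  subst this
  exact ⟨lam, h⟩

lemma mem_abacus_shift (t x : ℤ) (lam : Ptn) : x ∈ abacus 0 lam ↔ x + t ∈ abacus t lam := by
  constructor
  · rintro ⟨j, hj⟩; exact ⟨j, by omega⟩
  · rintro ⟨j, hj⟩; exact ⟨j, by omega⟩

end Aux2

noncomputable section Aux3

/-! ### the Uglov map -/

lemma mul_add_div_lt (e k r : ℤ) (h0 : 0 ≤ r) (h1 : r < e) : (e * k + r) / e = k := by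
  rw [Int.mul_add_ediv_left _ _ (by omega), Int.ediv_eq_zero_of_lt h0 h1, add_zero]

def uphi (e l : ℕ) (p : Fin l × ℤ) : ℤ :=
  ((l : ℤ) - 1 - ((p.1 : ℕ) : ℤ)) * (e : ℤ) + (p.2 / e) * (e : ℤ) * (l : ℤ) + p.2 % e

lemma uphi_eq (e l : ℕ) (p : Fin l × ℤ) :
    uphi e l p = (e : ℤ) * ((l : ℤ) * (p.2 / e) + ((l : ℤ) - 1 - ((p.1 : ℕ) : ℤ))) + p.2 % e := by
  unfold uphi; ring

lemma uphi_div (e l : ℕ) (he : 0 < e) (p : Fin l × ℤ) :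
    uphi e l p / e = (l : ℤ) * (p.2 / e) + ((l : ℤ) - 1 - ((p.1 : ℕ) : ℤ)) := by
  have he' : (0 : ℤ) < e := by exact_mod_cast he
  rw [uphi_eq, Int.mul_add_ediv_left _ _ he'.ne',
    Int.ediv_eq_zero_of_lt (Int.emod_nonneg _ he'.ne') (Int.emod_lt_of_pos _ he'), add_zero]

lemma uphi_mod (e l : ℕ) (p : Fin l × ℤ) : uphi e l p % e = p.2 % e := by
  rw [uphi_eq, Int.mul_add_emod_self_left, Int.emod_emod_of_dvd _ (dvd_refl _)]

lemma uphi_cast (e l : ℕ) (p : Fin l × ℤ) : (uphi e l p : ZMod e) = (p.2 : ZMod e) := by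
  rw [ZMod.intCast_eq_intCast_iff]
  exact uphi_mod e l p

lemma uphi_neg (e l : ℕ) (he : 0 < e) (p : Fin l × ℤ) : uphi e l p < 0 ↔ p.2 < 0 := by
  have he' : (0 : ℤ) < e := by exact_mod_cast he
  have h1 : ((p.1 : ℕ) : ℤ) < l := by exact_mod_cast p.1.2
  have key : ∀ x : ℤ, x < 0 ↔ x / (e : ℤ) < 0 := by
    intro x
    have := Int.le_ediv_iff_mul_le (a := 0) (b := x) he'
    simp at this
    constructor
    · intro h; by_contra hc; have := this.1 (by omega); omega
    · intro h; by_contra hc; have := this.2 (by omega); omega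
  rw [key, key p.2, uphi_div e l he]
  constructor
  · intro h
    by_contra hc
    push Not at hc
    have := mul_nonneg (show (0 : ℤ) ≤ l by omega) hc
    omega
  · intro h
    have : (l : ℤ) * (p.2 / e) ≤ l * (-1) := mul_le_mul_of_nonneg_left (by omega) (by omega)
    omega

lemma uphi_bij (e l : ℕ) (he : 0 < e) (hl : 0 < l) : Function.Bijective (uphi e l) := by
  have he' : (0 : ℤ) < e := by exact_mod_cast he
  have hl' : (0 : ℤ) < l := by exact_mod_cast hl
  constructor
  · rintro ⟨c, x⟩ ⟨c', x'⟩ h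
    have h1 : ((c : ℕ) : ℤ) < l := by exact_mod_cast c.2
    have h1' : ((c' : ℕ) : ℤ) < l := by exact_mod_cast c'.2
    have h2 := uphi_div e l he (c, x)
    have h3 := uphi_mod e l (c, x)
    rw [h, uphi_div e l he] at h2
    rw [h, uphi_mod] at h3
    simp only at h2 h3
    have hq : x' / (e : ℤ) = x / e := by
      have a1 : ((l : ℤ) * (x' / e) + ((l : ℤ) - 1 - ((c' : ℕ) : ℤ))) / l = x' / e := by
        exact mul_add_div_lt _ _ _ (by omega) (by omega)
      have a2 : ((l : ℤ) * (x / e) + ((l : ℤ) - 1 - ((c : ℕ) : ℤ))) / l = x / e := by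
        exact mul_add_div_lt _ _ _ (by omega) (by omega)
      rw [← a1, h2, a2]
    rw [hq] at h2
    have hc : c = c' := by ext; omega
    have hx : x = x' := by
      rw [← Int.mul_ediv_add_emod x e, ← Int.mul_ediv_add_emod x' e, hq, h3]
    rw [hc, hx]
  · intro y
    have a0 := Int.emod_nonneg (y / e) hl'.ne'
    have a1 := Int.emod_lt_of_pos (y / e) hl'
    have b0 := Int.emod_nonneg y he'.ne'
    have b1 := Int.emod_lt_of_pos y he'
    refine ⟨(⟨((l : ℤ) - 1 - (y / e) % l).toNat, by omega⟩, (e : ℤ) * (y / e / l) + y % e), ?_⟩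
    rw [uphi_eq]
    simp only
    rw [Int.mul_add_ediv_left _ _ he'.ne', Int.ediv_eq_zero_of_lt b0 b1, add_zero,
      Int.mul_add_emod_self_left, Int.emod_emod_of_dvd _ (dvd_refl _),
      Int.toNat_of_nonneg (by omega)]
    have c1 := Int.mul_ediv_add_emod (y / e) l
    have c2 := Int.mul_ediv_add_emod y e
    have : (l : ℤ) * (y / e / l) + (l - 1 - (l - 1 - y / e % l)) = y / e := by linarith
    rw [this, c2]

lemma mem_uglov (e l : ℕ) (he : 0 < e) (hl : 0 < l) (s : Fin l → ℤ) (lam : Fin l → Ptn)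
    (c : Fin l) (x : ℤ) : uphi e l (c, x) ∈ uglovSet e s lam ↔ x ∈ abacus (s c) (lam c) := by
  have he' : (0 : ℤ) < e := by exact_mod_cast he
  constructor
  · rintro ⟨c', q, r, hr, hm, hy⟩
    have : uphi e l (c', q * e + r) = uphi e l (c, x) := by
      rw [hy]
      unfold uphi
      simp only
      have hr' : (r : ℤ) < e := by exact_mod_cast hr
      have e1 : (q * (e : ℤ) + r) / e = q := by
        rw [mul_comm, Int.mul_add_ediv_left _ _ he'.ne', Int.ediv_eq_zero_of_lt (by omega) hr', add_zero]
      have e2 : (q * (e : ℤ) + r) % e = r := by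
        rw [mul_comm, Int.mul_add_emod_self_left, Int.emod_eq_of_lt (by omega) hr']
      rw [e1, e2]
    have := (uphi_bij e l he hl).1 this
    simp only [Prod.mk.injEq] at this
    obtain ⟨rfl, rfl⟩ := this
    exact hm
  · intro hx
    have b0 := Int.emod_nonneg x he'.ne'
    have b1 := Int.emod_lt_of_pos x he'
    refine ⟨c, x / e, (x % e).toNat, by omega, ?_, ?_⟩
    · rw [Int.toNat_of_nonneg b0, mul_comm, Int.mul_ediv_add_emod]; exact hx
    · rw [Int.toNat_of_nonneg b0]; rfl

lemma uglov_fiber (e l : ℕ) (he : 0 < e) (hl : 0 < l) (s : Fin l → ℤ) (lam : Fin l → Ptn)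
    (c : Fin l) : {x | uphi e l (c, x) ∈ uglovSet e s lam} = abacus (s c) (lam c) := by
  ext x; exact mem_uglov e l he hl s lam c x

lemma good_uglov (e l : ℕ) (he : 0 < e) (hl : 0 < l) (s : Fin l → ℤ) (lam : Fin l → Ptn) :
    Good (uglovSet e s lam) := by
  apply good_comp (uphi e l) (uphi_bij e l he hl) (uphi_neg e l he)
  intro c
  rw [uglov_fiber e l he hl]
  exact good_abacus _ _

lemma RS_uglov (e l : ℕ) (he : 0 < e) (hl : 0 < l) (s : Fin l → ℤ) (lam : Fin l → Ptn)
    (G : ℤ → ℚ) :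
    RS G (uglovSet e s lam) = ∑ c, RS (fun x => G (uphi e l (c, x))) (abacus (s c) (lam c)) := by
  rw [RS_decomp (uphi e l) (uphi_bij e l he hl) (uphi_neg e l he) _ (good_uglov e l he hl s lam)]
  simp only [uglov_fiber e l he hl]

lemma uglov_inj (e l : ℕ) (he : 0 < e) (hl : 0 < l) (p q : (Fin l → Ptn) × (Fin l → ℤ))
    (h : uglovSet e p.2 p.1 = uglovSet e q.2 q.1) : p = q := by
  have h1 : ∀ c, p.1 c = q.1 c ∧ p.2 c = q.2 c := by
    intro c
    apply abacus_inj
    rw [← uglov_fiber e l he hl, ← uglov_fiber e l he hl, h]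
  exact Prod.ext (funext fun c => (h1 c).1) (funext fun c => (h1 c).2)

lemma uphi_step1 (e l : ℕ) (i j : Fin l) (x : ℤ) (h : (j : ℕ) = (i : ℕ) + 1) :
    uphi e l (i, x) - e = uphi e l (j, x) := by
  unfold uphi
  simp only [h]
  push_cast; ring

lemma uphi_step2 (e l : ℕ) (he : 0 < e) (hl : 0 < l) (i j : Fin l) (x : ℤ) (h : (i : ℕ) = l - 1)
    (h' : (j : ℕ) = 0) :
    uphi e l (i, x) - e = uphi e l (j, x - e) := by
  have he' : (e : ℤ) ≠ 0 := by exact_mod_cast he.ne'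
  unfold uphi
  have h1 : (x - e) / (e : ℤ) = x / e - 1 := by
    rw [Int.sub_ediv_of_dvd _ (dvd_refl _), Int.ediv_self he']
  have h2 : (x - e) % (e : ℤ) = x % e := by simp
  simp only [h, h', h1, h2]
  have : ((l - 1 : ℕ) : ℤ) = l - 1 := by omega
  rw [this]
  push_cast; ring

lemma complete_stable (e l : ℕ) (he : 0 < e) (hl : 0 < l) (s : Fin l → ℤ) (lam : Fin l → Ptn)
    (h : Complete e s lam) : ∀ y ∈ uglovSet e s lam, y - e ∈ uglovSet e s lam := by
  intro y hy
  obtain ⟨⟨c, x⟩, rfl⟩ := (uphi_bij e l he hl).2 y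
  rw [mem_uglov e l he hl] at hy
  by_cases hc : (c : ℕ) + 1 < l
  · rw [uphi_step1 e l c ⟨c + 1, hc⟩ x rfl, mem_uglov e l he hl]
    exact h.1 c _ rfl hy
  · have hc' : (c : ℕ) = l - 1 := by have := c.2; omega
    rw [uphi_step2 e l he hl c ⟨0, hl⟩ x hc' rfl, mem_uglov e l he hl]
    exact h.2 c _ hc' rfl hy

lemma set_eq_of_fibers (e l : ℕ) (he : 0 < e) (hl : 0 < l) (U V : Set ℤ)
    (h : ∀ c x, uphi e l (c, x) ∈ U ↔ uphi e l (c, x) ∈ V) : U = V := by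
  ext y
  obtain ⟨⟨c, x⟩, rfl⟩ := (uphi_bij e l he hl).2 y
  exact h c x

lemma elemOp_mv (e l : ℕ) (he : 0 < e) (hl : 0 < l) (p q : (Fin l → Ptn) × (Fin l → ℤ))
    (h : ElemOp e p q) : Mv e (uglovSet e p.2 p.1) (uglovSet e q.2 q.1) ∧
      ∑ c, q.2 c = ∑ c, p.2 c := by
  have hinj := (uphi_bij e l he hl).1
  have gen : ∀ (i j : Fin l) (x x' : ℤ), uphi e l (i, x) - e = uphi e l (j, x') →
      x ∈ abacus (p.2 i) (p.1 i) → x' ∉ abacus (p.2 j) (p.1 j) →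
      (∀ c w, w ∈ abacus (q.2 c) (q.1 c) ↔
        (w ∈ abacus (p.2 c) (p.1 c) ∧ ¬ (c = i ∧ w = x)) ∨ (c = j ∧ w = x')) →
      Mv e (uglovSet e p.2 p.1) (uglovSet e q.2 q.1) := by
    intro i j x x' hst hx hx' hm
    refine ⟨uphi e l (i, x), (mem_uglov e l he hl _ _ _ _).2 hx, ?_, ?_⟩
    · rw [hst, mem_uglov e l he hl]; exact hx'
    · rw [hst]
      apply set_eq_of_fibers e l he hl
      intro c w
      rw [mem_uglov e l he hl, hm]
      simp only [Set.mem_union, Set.mem_sdiff, Set.mem_singleton_iff, mem_uglov e l he hl,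
        hinj.eq_iff, Prod.mk.injEq]
  have sumgen : ∀ i j : Fin l, i ≠ j → q.2 i = p.2 i - 1 → q.2 j = p.2 j + 1 →
      (∀ k, k ≠ i → k ≠ j → q.1 k = p.1 k ∧ q.2 k = p.2 k) → ∑ c, q.2 c = ∑ c, p.2 c := by
    intro i j hij hi hj hk
    have : ∀ c, q.2 c = p.2 c + ((if c = j then 1 else 0) - (if c = i then 1 else 0)) := by
      intro c
      by_cases h1 : c = i
      · subst h1; simp [hij, hi]; ring
      · by_cases h2 : c = j
        · subst h2; simp [h1, hj]
        · simp [h1, h2, (hk c h1 h2).2]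
    simp only [this, Finset.sum_add_distrib, Finset.sum_sub_distrib]
    simp
  rcases h with ⟨i, j, x, hij, hx, hx', hi, hj, hi2, hj2, hk⟩ | ⟨i, j, x, hi0, hj0, hx, hx', heq, hne, hk⟩
  · have hne : i ≠ j := by intro h; subst h; omega
    refine ⟨gen i j x x (uphi_step1 e l i j x hij) hx hx' ?_, sumgen i j hne hi2 hj2 hk⟩
    intro c w
    by_cases h1 : c = i
    · subst h1; simp [hi, hne]
    · by_cases h2 : c = j
      · subst h2; simp [hj, h1, or_comm]
      · simp [h1, h2, hk c h1 h2]
  · by_cases hij : i = j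
    · obtain ⟨h1, h2⟩ := heq hij
      subst hij
      refine ⟨gen i i x (x - e) (uphi_step2 e l he hl i i x hi0 hj0) hx hx' ?_, ?_⟩
      · intro c w
        by_cases hc : c = i
        · subst hc; simp [h1, or_comm]
        · simp [hc, hk c hc hc]
      · apply Finset.sum_congr rfl
        intro c _
        by_cases hc : c = i
        · subst hc; exact h2
        · exact (hk c hc hc).2
    · obtain ⟨h1, h2, h3, h4⟩ := hne hij
      refine ⟨gen i j x (x - e) (uphi_step2 e l he hl i j x hi0 hj0) hx hx' ?_, sumgen i j hij h3 h4 hk⟩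
      intro c w
      by_cases hc : c = i
      · subst hc; simp [h1, hij]
      · by_cases hc2 : c = j
        · subst hc2; simp [h2, hc, or_comm]
        · simp [hc, hc2, hk c hc hc2]

/-! ### residue counts -/

lemma exists_bound {l : ℕ} (lam : Fin l → Ptn) : ∃ N, ∀ c n, N ≤ n → (lam c).parts n = 0 := by
  choose N hN using fun c => (lam c).eventually_zero
  exact ⟨Finset.univ.sup N, fun c n hn => hN c n (le_trans (Finset.le_sup (Finset.mem_univ c)) hn)⟩

lemma resCount_eq (e l : ℕ) (s : Fin l → ℤ) (lam : Fin l → Ptn) (N : ℕ)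
    (hN : ∀ c n, N ≤ n → (lam c).parts n = 0) (z : ZMod e) :
    (resCount e s lam z : ℚ) = ∑ c, ∑ j ∈ Finset.range N, ∑ b ∈ Finset.range ((lam c).parts j),
      rInd e z ((b : ℤ) - j + s c) := by
  let T : Finset (Σ _ : Fin l, Σ _ : ℕ, ℕ) :=
    Finset.univ.sigma fun c => (Finset.range N).sigma fun j => Finset.range ((lam c).parts j)
  let g : (Σ _ : Fin l, Σ _ : ℕ, ℕ) → ℕ × ℕ × Fin l := fun t => (t.2.1, t.2.2, t.1)
  have hg : Function.Injective g := by
    rintro ⟨a, b, c⟩ ⟨a', b', c'⟩ h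
    simp only [g, Prod.mk.injEq] at h
    obtain ⟨rfl, rfl, rfl⟩ := h
    rfl
  have h1 : {x ∈ diag lam | res e s x = z} =
      ((T.filter (fun t => res e s (g t) = z)).image g : Finset _) := by
    ext ⟨a, b, c⟩
    simp only [Finset.coe_image, Set.mem_image, Finset.mem_coe, Finset.mem_filter]
    constructor
    · rintro ⟨hd, hr⟩
      have hd' : b < (lam c).parts a := hd
      refine ⟨⟨c, a, b⟩, ⟨?_, hr⟩, rfl⟩
      simp only [T, Finset.mem_sigma, Finset.mem_univ, Finset.mem_range, true_and]
      refine ⟨?_, hd'⟩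
      by_contra hc
      rw [hN c a (by omega)] at hd'
      omega
    · rintro ⟨⟨c', a', b'⟩, ⟨ht, hr⟩, h⟩
      simp only [g, Prod.mk.injEq] at h
      obtain ⟨rfl, rfl, rfl⟩ := h
      simp only [T, Finset.mem_sigma, Finset.mem_univ, Finset.mem_range, true_and] at ht
      exact ⟨ht.2, hr⟩
  unfold resCount
  rw [h1, Set.ncard_coe_finset, Finset.card_image_of_injective _ hg, Finset.card_filter]
  push_cast
  simp only [T, Finset.sum_sigma]
  rfl

lemma RS_uglov_sub (e l : ℕ) (he : 0 < e) (hl : 0 < l) (s : Fin l → ℤ) (lam : Fin l → Ptn)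
    (N : ℕ) (hN : ∀ c n, N ≤ n → (lam c).parts n = 0) (G : ℤ → ℚ) :
    RS G (uglovSet e s lam) = RS G (uglovSet e s (fun _ => Ptn.empty)) +
      ∑ c, ∑ j ∈ Finset.range N, ∑ b ∈ Finset.range ((lam c).parts j),
        (G (uphi e l (c, (b : ℤ) - j + s c)) - G (uphi e l (c, (b : ℤ) - j + s c - 1))) := by
  rw [RS_uglov e l he hl, RS_uglov e l he hl, ← Finset.sum_add_distrib]
  apply Finset.sum_congr rfl
  intro c _
  rw [RS_abacus_sub _ _ N (hN c), abacus_empty]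

lemma EN_uglov (e l : ℕ) (he : 0 < e) (hl : 0 < l) (s : Fin l → ℤ) (lam : Fin l → Ptn) :
    EN e (uglovSet e s lam) = EN e (uglovSet e s (fun _ => Ptn.empty)) + l * resCount e s lam 0 := by
  obtain ⟨N, hN⟩ := exists_bound lam
  have he' : (0 : ℤ) < e := by exact_mod_cast he
  unfold EN
  rw [RS_uglov_sub e l he hl s lam N hN, resCount_eq e l s lam N hN]
  simp only [Finset.mul_sum]
  congr 1
  refine Finset.sum_congr rfl fun c _ => Finset.sum_congr rfl fun j _ => Finset.sum_congr rfl fun b _ => ?_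
  generalize (b : ℤ) - j + s c = k
  rw [uphi_div e l he, uphi_div e l he]
  simp only
  have h1 := Int.mul_ediv_add_emod k e
  have h2 := Int.mul_ediv_add_emod (k - 1) e
  have a0 := Int.emod_nonneg k he'.ne'
  have a1 := Int.emod_lt_of_pos k he'
  by_cases h : (e : ℤ) ∣ k
  · have hk : (k : ZMod e) = 0 := (ZMod.intCast_zmod_eq_zero_iff_dvd k e).2 h
    have : (k - 1) / (e : ℤ) = k / e - 1 := by
      obtain ⟨q, rfl⟩ := h
      rw [Int.mul_ediv_cancel_left _ he'.ne']
      have : (e : ℤ) * q - 1 = e * (q - 1) + (e - 1) := by ring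
      rw [this, Int.mul_add_ediv_left _ _ he'.ne', Int.ediv_eq_zero_of_lt (by omega) (by omega), add_zero]
    rw [this]
    simp only [rInd, hk, if_true]
    push_cast; ring
  · have hk : (k : ZMod e) ≠ 0 := fun hc => h ((ZMod.intCast_zmod_eq_zero_iff_dvd k e).1 hc)
    have h0 : k % e ≠ 0 := fun hc => h (Int.dvd_of_emod_eq_zero hc)
    have : (k - 1) / (e : ℤ) = k / e := by
      have : k - 1 = (e : ℤ) * (k / e) + (k % e - 1) := by linarith
      rw [this]
      exact mul_add_div_lt _ _ _ (by omega) (by omega)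
    rw [this]
    simp [rInd, hk]

lemma nch_uglov (e l : ℕ) (he : 0 < e) (hl : 0 < l) (s : Fin l → ℤ) (lam : Fin l → Ptn)
    (z : ZMod e) :
    nch e (uglovSet e s lam) z = nch e (uglovSet e s (fun _ => Ptn.empty)) z +
      (resCount e s lam z - resCount e s lam (z + 1)) := by
  obtain ⟨N, hN⟩ := exists_bound lam
  unfold nch
  rw [RS_uglov_sub e l he hl s lam N hN, resCount_eq e l s lam N hN, resCount_eq e l s lam N hN]
  simp only [← Finset.sum_sub_distrib]
  congr 1
  refine Finset.sum_congr rfl fun c _ => Finset.sum_congr rfl fun j _ => Finset.sum_congr rfl fun b _ => ?_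
  generalize (b : ℤ) - j + s c = k
  unfold rInd
  rw [uphi_cast, uphi_cast]
  simp only
  have : ((k - 1 : ℤ) : ZMod e) = z ↔ (k : ZMod e) = z + 1 := by
    push_cast; exact sub_eq_iff_eq_add
  simp only [this]

lemma vacuum_sum (e l : ℕ) [NeZero e] (hl : 0 < l) (s : Fin l → ℤ) (C : ZMod e → ℚ) :
    ∑ z, (C z - C (z + 1)) * nch e (uglovSet e s (fun _ => Ptn.empty)) z
      = l * C 0 - ∑ c, C (s c) := by
  have he := Nat.pos_of_neZero e
  unfold nch
  rw [RS_sum _ _ _ (good_uglov e l he hl s _), RS_uglov e l he hl]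
  have : ∀ c : Fin l, RS (fun x => ∑ i, (C i - C (i + 1)) * rInd e i (uphi e l (c, x)))
      (abacus (s c) Ptn.empty) = C 0 - C (s c) := by
    intro c
    rw [abacus_empty, RS_Iio_eq _ (fun t => - C (t : ZMod e))]
    · push_cast; ring
    · intro t
      unfold rInd
      simp only [uphi_cast]
      push_cast
      simp
      ring
  simp only [this, Finset.sum_sub_distrib]
  simp

lemma vacuum_complete (e l : ℕ) (s : Fin l → ℤ) (hs : Aset e s) :
    Complete e s (fun _ => Ptn.empty) := by
  constructor
  · intro i j hij
    simp only [abacus_empty]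
    have := (hs i j (by rw [Fin.lt_def]; omega)).1
    intro x hx
    simp only [Set.mem_Iio] at *
    omega
  · intro i j hi hj
    simp only [abacus_empty]
    intro x hx
    change x - e < s j
    simp only [Set.mem_Iio] at hx
    by_cases h : j = i
    · subst h; omega
    · have h' : (j : ℕ) ≠ i := fun h2 => h (Fin.ext h2)
      have := (hs j i (by rw [Fin.lt_def]; omega)).2
      omega

lemma weight_formula (e l : ℕ) [NeZero e] (hl : 0 < l) (s : Fin l → ℤ) (hs : Aset e s)
    (lam : Fin l → Ptn) :
    EN e (uglovSet e s lam) - ∑ z : ZMod e, nch e (uglovSet e s lam) z *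
      (nch e (uglovSet e s lam) z - 1) / 2 = blockWeight e s lam := by
  have he := Nat.pos_of_neZero e
  have h0 := stable_energy e (uglovSet e s (fun _ => Ptn.empty)) (good_uglov e l he hl s _)
    (complete_stable e l he hl s _ (vacuum_complete e l s hs))
  set C : ZMod e → ℚ := fun z => resCount e s lam z with hC
  have hv := vacuum_sum e l hl s C
  have hn : ∀ z, nch e (uglovSet e s lam) z = nch e (uglovSet e s (fun _ => Ptn.empty)) z +
      (C z - C (z + 1)) := nch_uglov e l he hl s lam
  have hE : EN e (uglovSet e s lam) = EN e (uglovSet e s (fun _ => Ptn.empty)) + l * C 0 :=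
    EN_uglov e l he hl s lam
  have hshift : ∀ F : ZMod e → ℚ, ∑ z, F (z + 1) = ∑ z, F z :=
    fun F => Equiv.sum_comp (Equiv.addRight (1 : ZMod e)) F
  have hrange : ∑ i ∈ Finset.range e, (C (i : ZMod e) - C ((i : ZMod e) - 1)) ^ 2
      = ∑ z, (C z - C (z + 1)) ^ 2 := by
    rw [Finset.sum_range (fun i => (C (i : ZMod e) - C ((i : ZMod e) - 1)) ^ 2),
      sum_fin_zmod e (fun z => (C z - C (z - 1)) ^ 2), ← hshift]
    apply Finset.sum_congr rfl
    intro z _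
    rw [add_sub_cancel_right]; ring
  have hd : ∑ z, (C z - C (z + 1)) = 0 := by
    rw [Finset.sum_sub_distrib, hshift, sub_self]
  have hB : blockWeight e s lam = (∑ c, C (s c)) - 1 / 2 * ∑ z, (C z - C (z + 1)) ^ 2 := by
    rw [← hrange]; rfl
  rw [hB, hE, h0]
  simp only [hn]
  have hexp : ∀ z, (nch e (uglovSet e s fun _ => Ptn.empty) z + (C z - C (z + 1))) *
      (nch e (uglovSet e s fun _ => Ptn.empty) z + (C z - C (z + 1)) - 1) / 2
      = nch e (uglovSet e s fun _ => Ptn.empty) z * (nch e (uglovSet e s fun _ => Ptn.empty) z - 1) / 2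
        + (C z - C (z + 1)) * nch e (uglovSet e s fun _ => Ptn.empty) z
        + 1 / 2 * (C z - C (z + 1)) ^ 2 - 1 / 2 * (C z - C (z + 1)) := by
    intro z; ring
  simp only [hexp, Finset.sum_add_distrib, Finset.sum_sub_distrib, hv, ← Finset.mul_sum] at hd ⊢
  linarith

/-! ### sequences of operations -/

lemma opSeq_facts (e l : ℕ) (he : 0 < e) (hl : 0 < l) (p : (Fin l → Ptn) × (Fin l → ℤ))
    (f : ℕ → (Fin l → Ptn) × (Fin l → ℤ)) (n : ℕ) (h : OpSeq e p f n) :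
    ∀ k ≤ n, EN e (uglovSet e (f k).2 (f k).1) = EN e (uglovSet e p.2 p.1) - k ∧
      (∀ z, nch e (uglovSet e (f k).2 (f k).1) z = nch e (uglovSet e p.2 p.1) z) ∧
      RS (fun _ => 1) (uglovSet e (f k).2 (f k).1) = RS (fun _ => 1) (uglovSet e p.2 p.1) ∧
      ∑ c, (f k).2 c = ∑ c, p.2 c := by
  intro k
  induction k with
  | zero => intro _; rw [h.1]; simp
  | succ k ih =>
    intro hk
    obtain ⟨h1, h2, h3, h4⟩ := ih (by omega)
    obtain ⟨hm, hsum⟩ := elemOp_mv e l he hl _ _ (h.2 k (by omega))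
    have hg := good_uglov e l he hl (f k).2 (f k).1
    refine ⟨?_, ?_, ?_, ?_⟩
    · rw [hm.en he hg, h1]; push_cast; ring
    · intro z; rw [hm.nch hg, h2]
    · rw [hm.charge hg, h3]
    · rw [hsum, h4]

end Aux3

/-- every maximal sequence of elementary operations starting from
`(𝛌,s)` has length `p_{(e,s)}(𝛌)` and ends at the same pair `(𝛍,v)`, which satisfies
`v_1+…+v_l = s_1+…+s_l`, `𝛍` is a reduced `(e,v)`-core, and
`τ_{e,v}(𝛍) = Core_e(τ_{e,s}(𝛌))`. -/
theorem stmt18 (e l : ℕ) (he : 2 ≤ e) (hl : 1 ≤ l) (s : Fin l → ℤ) (hs : Aset e s)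
    (lam : Fin l → Ptn) :
    (∀ f n, MaxOpSeq e (lam, s) f n →
      (n : ℚ) = blockWeight e s lam ∧
      (∑ i, (f n).2 i) = (∑ i, s i) ∧
      Complete e (f n).2 (f n).1 ∧
      (∀ tmu tlam : Ptn, IsUglov e (f n).2 (f n).1 tmu → IsUglov e s lam tlam →
        IsECoreOf e tmu tlam)) ∧
    (∀ f n g m, MaxOpSeq e (lam, s) f n → MaxOpSeq e (lam, s) g m → f n = g m) := by
  have he0 : 0 < e := by omega
  have hl0 : 0 < l := by omega
  haveI : NeZero e := ⟨he0.ne'⟩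
  constructor
  · intro f n hf
    have facts := opSeq_facts e l he0 hl0 _ f n hf.1
    obtain ⟨h1, h2, h3, h4⟩ := facts n le_rfl
    have hst := complete_stable e l he0 hl0 _ _ hf.2
    refine ⟨?_, h4, hf.2, ?_⟩
    · have hE := stable_energy e _ (good_uglov e l he0 hl0 _ _) hst
      have hW := weight_formula e l hl0 s hs lam
      simp only [h2] at hE
      rw [h1] at hE
      simp only at hE
      linarith
    · intro tmu tlam hmu hlam
      unfold IsUglov at hmu hlam
      rw [h4] at hmu
      simp only at hmu
      set t := ∑ i, s i with ht
      have hch : RS (fun _ => 1) (uglovSet e s lam) = t := by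
        rw [← hlam, charge_abacus]
      have hex : ∀ k, ∃ nu : Ptn, k ≤ n → abacus t nu = uglovSet e (f k).2 (f k).1 := by
        intro k
        by_cases hk : k ≤ n
        · obtain ⟨nu, hnu⟩ := exists_abacus_charge (uglovSet e (f k).2 (f k).1)
            (good_uglov e l he0 hl0 _ _) t (by rw [(facts k hk).2.2.1]; exact hch)
          exact ⟨nu, fun _ => hnu⟩
        · exact ⟨Ptn.empty, fun h => absurd h hk⟩
      choose g hg using hex
      refine ⟨?_, g, n, ?_, ?_, ?_⟩
      · intro x hx
        rw [mem_abacus_shift t] at hx ⊢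
        rw [hmu] at hx ⊢
        have := hst _ hx
        rwa [show x + t - (e : ℤ) = x - e + t by ring] at this
      · apply (abacus_inj (s := t) (s' := t) _).1
        rw [hg 0 (by omega), hlam, hf.1.1]
      · apply (abacus_inj (s := t) (s' := t) _).1
        rw [hg n le_rfl, hmu]
      · intro k hk
        obtain ⟨⟨y, hy1, hy2, hy3⟩, _⟩ := elemOp_mv e l he0 hl0 _ _ (hf.1.2 k hk)
        rw [← hg k hk.le] at hy1 hy2 hy3
        rw [← hg (k + 1) hk] at hy3
        refine ⟨y - t, ?_, ?_, ?_⟩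
        · rw [mem_abacus_shift t]; simpa using hy1
        · rw [mem_abacus_shift t, show y - t - e + t = y - (e : ℤ) by ring]; exact hy2
        · ext x
          rw [mem_abacus_shift t, hy3]
          simp only [Set.mem_union, Set.mem_diff, Set.mem_singleton_iff]
          rw [← mem_abacus_shift t]
          constructor
          · rintro (⟨a, b⟩ | a)
            · exact Or.inl ⟨a, by omega⟩
            · exact Or.inr (by omega)
          · rintro (⟨a, b⟩ | a)
            · exact Or.inl ⟨a, by omega⟩
            · exact Or.inr (by omega)
  · intro f n g m hf hg
    obtain ⟨_, h2, _, _⟩ := opSeq_facts e l he0 hl0 _ f n hf.1 n le_rfl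
    obtain ⟨_, h2', _, _⟩ := opSeq_facts e l he0 hl0 _ g m hg.1 m le_rfl
    apply uglov_inj e l he0 hl0
    apply stable_unique e he0 _ _ (good_uglov e l he0 hl0 _ _) (good_uglov e l he0 hl0 _ _)
      (complete_stable e l he0 hl0 _ _ hf.2) (complete_stable e l he0 hl0 _ _ hg.2)
    intro z
    rw [h2, h2']
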